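/- Let X be a continuum such that NB(F₁(X)) = F₁(X). Then X is decomposable, and every indecomposable subcontinuum of X has empty interior. -/

import Mathlib

open Set Filter Metric

/-- `B` does not block `x`: the union of all subcontinua of `X` containing `x`
and contained in the complement of `B` is dense. -/
def NotBlocks {X : Type*} [TopologicalSpace X] (B : Set X) (x : X) : Prop :=
  Dense (⋃₀ {K : Set X | IsCompact K ∧ IsConnected K ∧ x ∈ K ∧ K ⊆ Bᶜ})

/-- The hyperspace `NB(F₁(X))`: nonempty proper closed subsets that do not block
any point of their complement. -/
def NB (X : Type*) [TopologicalSpace X] : Set (Set X) :=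
  {B | B.Nonempty ∧ B ≠ univ ∧ IsClosed B ∧ ∀ x ∉ B, NotBlocks B x}

/-- The hyperspace `NB*(F₁(X))`: nonempty proper closed subsets that do not block
at least one point of their complement. -/
def NBstar (X : Type*) [TopologicalSpace X] : Set (Set X) :=
  {B | B.Nonempty ∧ B ≠ univ ∧ IsClosed B ∧ ∃ x ∉ B, NotBlocks B x}

/-- `F₁(X)`: the one-point subsets of `X`. -/
def F1 (X : Type*) [TopologicalSpace X] : Set (Set X) :=
  {A | ∃ x : X, A = {x}}

/-- `NWC(X)`: nonempty proper closed subsets with empty interior that are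
non-weak cut sets. -/
def NWC (X : Type*) [TopologicalSpace X] : Set (Set X) :=
  {A | A.Nonempty ∧ A ≠ univ ∧ IsClosed A ∧ interior A = ∅ ∧
    ∀ x ∉ A, ∀ y ∉ A, ∃ K : Set X, IsCompact K ∧ IsConnected K ∧ K ⊆ Aᶜ ∧ x ∈ K ∧ y ∈ K}

/-- A shore set: a nonempty proper closed subset `A` such that some sequence of
subcontinua contained in the complement of `A` converges to `X` in the Hausdorff metric. -/
def ShoreSet {X : Type*} [MetricSpace X] (A : Set X) : Prop :=
  A.Nonempty ∧ A ≠ univ ∧ IsClosed A ∧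
    ∃ C : ℕ → Set X, (∀ n, IsCompact (C n) ∧ IsConnected (C n) ∧ C n ⊆ Aᶜ) ∧
      Tendsto (fun n => hausdorffDist (C n) (univ : Set X)) atTop (nhds 0)

/-- `S(X)`: the collection of all shore sets of `X`. -/
def Shore (X : Type*) [MetricSpace X] : Set (Set X) :=
  {A | ShoreSet A}

/-- The composant of a point `z`: the union of all proper subcontinua containing `z`. -/
def composant {X : Type*} [TopologicalSpace X] (z : X) : Set X :=
  ⋃₀ {L : Set X | IsCompact L ∧ IsConnected L ∧ L ≠ univ ∧ z ∈ L}

/-- `X` is irreducible between `p` and `q`: no proper subcontinuum contains both. -/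
def IrrBetween {X : Type*} [TopologicalSpace X] (p q : X) : Prop :=
  ∀ L : Set X, IsCompact L → IsConnected L → p ∈ L → q ∈ L → L = univ

/-- A subcontinuum `K` is decomposable if it is the union of two proper subcontinua. -/
def DecomposableSet {X : Type*} [TopologicalSpace X] (K : Set X) : Prop :=
  ∃ A B : Set X, IsCompact A ∧ IsConnected A ∧ A ⊆ K ∧ A ≠ K ∧
    IsCompact B ∧ IsConnected B ∧ B ⊆ K ∧ B ≠ K ∧ A ∪ B = K

/-- `s(x)` relative to the point `p`: the union of all subcontinua containing `x`
and contained in `X \ {p}`. -/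
def sComp {X : Type*} [TopologicalSpace X] (p x : X) : Set X :=
  ⋃₀ {K : Set X | IsCompact K ∧ IsConnected K ∧ x ∈ K ∧ K ⊆ ({p} : Set X)ᶜ}

/-! ### Connectedness -/

theorem IsClosed.isClosed_connectedComponentIn {X : Type*} [TopologicalSpace X] {F : Set X}
    (hF : IsClosed F) (x : X) : IsClosed (connectedComponentIn F x) := by
  by_cases hx : x ∈ F
  · refine isClosed_of_closure_subset ?_
    exact isPreconnected_connectedComponentIn.closure.subset_connectedComponentIn
      (subset_closure (mem_connectedComponentIn hx))
      (closure_minimal (connectedComponentIn_subset F x) hF)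
  · rw [connectedComponentIn_eq_empty hx]
    exact isClosed_empty

/-- Adding to a connected closed set `Y` one side of a separation of `K \ Y` keeps it connected. -/
theorem IsPreconnected.union_sdiff_inter {X : Type*} [TopologicalSpace X] {K Y u v : Set X}
    (hK : IsPreconnected K) (hKc : IsClosed K) (hY : IsConnected Y) (hYc : IsClosed Y)
    (hYK : Y ⊆ K) (hu : IsOpen u) (hv : IsOpen v) (huv : K \ Y ⊆ u ∪ v)
    (hd : ∀ x ∈ K \ Y, x ∈ u → x ∉ v) :
    IsClosed (Y ∪ (K \ Y) ∩ u) ∧ IsConnected (Y ∪ (K \ Y) ∩ u) := by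
  have closed : ∀ s t : Set X, IsOpen t → K \ Y ⊆ s ∪ t →
      (∀ x ∈ K \ Y, x ∈ s → x ∉ t) → IsClosed (Y ∪ (K \ Y) ∩ s) := by
    intro s t ht hst hd
    have : Y ∪ (K \ Y) ∩ s = Y ∪ K ∩ tᶜ := by
      ext x
      have h1 := @hst x
      have h2 := hd x
      have h3 := @hYK x
      simp only [mem_union, mem_inter_iff, Set.mem_sdiff, mem_compl_iff] at *
      tauto
    rw [this]
    exact hYc.union (hKc.inter ht.isClosed_compl)
  have hZ := closed u v hv huv hd
  have hZ' := closed v u hu (by rwa [union_comm]) (fun x hx h1 h2 => hd x hx h2 h1)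
  refine ⟨hZ, hY.nonempty.mono subset_union_left, ?_⟩
  have key : ∀ t t' : Set X, IsClosed t → IsClosed t' → Y ∪ (K \ Y) ∩ u ⊆ t ∪ t' →
      Disjoint t t' → Y ⊆ t → Y ∪ (K \ Y) ∩ u ⊆ t := by
    intro t t' ht ht' hsub hdis hYt
    have hdis' : ∀ x ∈ t, x ∉ t' := fun x h1 h2 => Set.disjoint_left.1 hdis h1 h2
    have hcov := (isPreconnected_iff_subset_of_fully_disjoint_closed hKc).1 hK
      ((t ∩ (Y ∪ (K \ Y) ∩ u)) ∪ (Y ∪ (K \ Y) ∩ v)) ((Y ∪ (K \ Y) ∩ u) ∩ t')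
      ((ht.inter hZ).union hZ') (hZ.inter ht') ?_ ?_
    · rcases hcov with h | h
      · intro x hx
        by_contra hxt
        have hxt' : x ∈ t' := (hsub hx).resolve_left hxt
        have hxK : x ∈ K := by
          rcases hx with hx | hx
          · exact hYK hx
          · exact hx.1.1
        have h1 := h hxK
        have h2 := hd x
        have h3 := @hYt x
        simp only [mem_union, mem_inter_iff, Set.mem_sdiff] at *
        tauto
      · obtain ⟨y, hy⟩ := hY.nonempty
        exact absurd (h (hYK hy)).2 (hdis' y (hYt hy))
    · intro x hx
      have h1 := @hsub x
      have h2 := @huv x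
      simp only [mem_union, mem_inter_iff, Set.mem_sdiff] at *
      tauto
    · rw [Set.disjoint_left]
      intro x hx hx'
      have h2 := hd x
      have h3 := @hYt x
      have h4 := hdis' x
      simp only [mem_union, mem_inter_iff, Set.mem_sdiff] at *
      tauto
  rw [isPreconnected_iff_subset_of_fully_disjoint_closed hZ]
  intro t t' ht ht' hsub hdis
  rcases (isPreconnected_iff_subset_of_fully_disjoint_closed hYc).1 hY.isPreconnected t t' ht ht'
    (subset_union_left.trans hsub) hdis with h | h
  · exact Or.inl (key t t' ht ht' hsub hdis h)
  · exact Or.inr (key t' t ht' ht (by rwa [union_comm t' t]) hdis.symm h)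

/-- Boundary bumping: a component of `M ∩ A` reaches the closure of the complement of `A`
unless the continuum `M` is contained in `A`. -/
theorem connectedComponentIn_inter_closure_compl_nonempty {X : Type*}
    [TopologicalSpace X] [T2Space X] {M A : Set X} (hM : IsPreconnected M) (hMc : IsCompact M)
    (hA : IsClosed A) {x : X} (hx : x ∈ M ∩ A) (hMA : ¬ M ⊆ A) :
    (connectedComponentIn (M ∩ A) x ∩ closure Aᶜ).Nonempty := by
  by_contra hne
  rw [Set.not_nonempty_iff_eq_empty] at hne
  have hS : IsCompact (M ∩ A) := hMc.inter_right hA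
  have : CompactSpace (M ∩ A : Set X) := isCompact_iff_compactSpace.1 hS
  let x' : (M ∩ A : Set X) := ⟨x, hx⟩
  have hF : IsClosed ((↑) ⁻¹' closure Aᶜ : Set (M ∩ A : Set X)) :=
    isClosed_closure.preimage continuous_subtype_val
  have hempty : ((↑) ⁻¹' closure Aᶜ : Set (M ∩ A : Set X)) ∩
      ⋂ s : { s : Set (M ∩ A : Set X) // IsClopen s ∧ x' ∈ s }, s = ∅ := by
    rw [← connectedComponent_eq_iInter_isClopen x', Set.eq_empty_iff_forall_notMem]
    rintro y ⟨hy1, hy2⟩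
    have : (y : X) ∈ connectedComponentIn (M ∩ A) x := by
      rw [connectedComponentIn_eq_image hx]
      exact ⟨y, hy2, rfl⟩
    exact (Set.eq_empty_iff_forall_notMem.1 hne y) ⟨this, hy1⟩
  have : Nonempty { s : Set (M ∩ A : Set X) // IsClopen s ∧ x' ∈ s } :=
    ⟨⟨univ, isClopen_univ, mem_univ _⟩⟩
  obtain ⟨⟨E, hE, hxE⟩, hdis⟩ := hF.isCompact.elim_directed_family_closed
    (fun s : { s : Set (M ∩ A : Set X) // IsClopen s ∧ x' ∈ s } => (s : Set (M ∩ A : Set X)))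
    (fun s => s.2.1.1) hempty (fun a b =>
      ⟨⟨a.1 ∩ b.1, a.2.1.inter b.2.1, a.2.2, b.2.2⟩, inter_subset_left, inter_subset_right⟩)
  obtain ⟨G, hG, rfl⟩ := isOpen_induced_iff.1 hE.2
  obtain ⟨H, hH, hHE⟩ := isClosed_induced_iff.1 hE.1
  have hint : ∀ y ∈ M ∩ A, y ∈ G → y ∉ closure Aᶜ := fun y hy hyG hyc =>
    Set.eq_empty_iff_forall_notMem.1 hdis ⟨y, hy⟩ ⟨hyc, hyG⟩
  have hHG : ∀ y ∈ M ∩ A, y ∈ H ↔ y ∈ G := fun y hy =>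
    Set.ext_iff.1 hHE ⟨y, hy⟩
  apply hMA
  have hcov := isPreconnected_iff_subset_of_disjoint.1 hM (G ∩ (closure Aᶜ)ᶜ) (H ∩ A)ᶜ
    (hG.inter isClosed_closure.isOpen_compl) (hH.inter hA).isOpen_compl ?_ ?_
  · rcases hcov with h | h
    · intro y hy
      by_contra hyA
      exact (h hy).2 (subset_closure hyA)
    · exact absurd ⟨(hHG x hx).2 hxE, hx.2⟩ (h hx.1)
  · intro y hy
    by_cases hyH : y ∈ H ∩ A
    · have hyG := (hHG y ⟨hy, hyH.2⟩).1 hyH.1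
      exact Or.inl ⟨hyG, hint y ⟨hy, hyH.2⟩ hyG⟩
    · exact Or.inr hyH
  · rw [Set.eq_empty_iff_forall_notMem]
    rintro y ⟨hyM, ⟨hyG, hyA⟩, hyH⟩
    have hyA' : y ∈ A := by
      by_contra h
      exact hyA (subset_closure h)
    exact hyH ⟨(hHG y ⟨hyM, hyA'⟩).2 hyG, hyA'⟩

/-! ### Indecomposable continua -/

/-- A proper subcontinuum of an indecomposable continuum is nowhere dense. -/
theorem interior_eq_empty_of_not_decomposableSet {X : Type*} [TopologicalSpace X] [T2Space X]
    {K Y : Set X} (hK : IsCompact K) (hKconn : IsConnected K) (hKd : ¬ DecomposableSet K)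
    (hY : IsCompact Y) (hYconn : IsConnected Y) (hYK : Y ⊆ K) (hne : Y ≠ K) :
    interior Y = ∅ := by
  by_contra hint
  obtain ⟨z, hz⟩ := Set.nonempty_iff_ne_empty.2 hint
  have hdiff : (K \ Y).Nonempty := by
    rw [Set.sdiff_nonempty]
    exact fun h => hne (hYK.antisymm h)
  apply hKd
  by_cases hc : IsPreconnected (K \ Y)
  · have hsub : closure (K \ Y) ⊆ K := closure_minimal sdiff_subset hK.isClosed
    refine ⟨Y, closure (K \ Y), hY, hYconn, hYK, hne, hK.of_isClosed_subset isClosed_closure hsub,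
      ⟨hdiff.closure, hc.closure⟩, hsub, ?_, ?_⟩
    · intro h
      have hzc : z ∈ closure (K \ Y) := h.ge (hYK (interior_subset hz))
      obtain ⟨w, hw1, hw2⟩ := mem_closure_iff.1 hzc _ isOpen_interior hz
      exact hw2.2 (interior_subset hw1)
    · refine (union_subset hYK hsub).antisymm fun y hy => ?_
      by_cases h : y ∈ Y
      · exact Or.inl h
      · exact Or.inr (subset_closure ⟨hy, h⟩)
  · unfold IsPreconnected at hc
    push Not at hc
    obtain ⟨u, v, hu, hv, huv, ⟨a, ha⟩, ⟨b, hb⟩, hd⟩ := hc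
    have hd1 : ∀ x ∈ K \ Y, x ∈ u → x ∉ v := fun x hx h1 h2 =>
      Set.eq_empty_iff_forall_notMem.1 hd x ⟨hx, h1, h2⟩
    have hd2 : ∀ x ∈ K \ Y, x ∈ v → x ∉ u := fun x hx h1 h2 => hd1 x hx h2 h1
    obtain ⟨c1, d1⟩ := hKconn.isPreconnected.union_sdiff_inter hK.isClosed hYconn hY.isClosed
      hYK hu hv huv hd1
    obtain ⟨c2, d2⟩ := hKconn.isPreconnected.union_sdiff_inter hK.isClosed hYconn hY.isClosed
      hYK hv hu (by rwa [union_comm]) hd2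
    have s1 : Y ∪ (K \ Y) ∩ u ⊆ K := union_subset hYK (inter_subset_left.trans sdiff_subset)
    have s2 : Y ∪ (K \ Y) ∩ v ⊆ K := union_subset hYK (inter_subset_left.trans sdiff_subset)
    refine ⟨_, _, hK.of_isClosed_subset c1 s1, d1, s1, ?_, hK.of_isClosed_subset c2 s2, d2, s2,
      ?_, (union_subset s1 s2).antisymm fun y hy => ?_⟩
    · intro h
      have : b ∈ Y ∪ (K \ Y) ∩ u := h.ge hb.1.1
      rcases this with h | h
      · exact hb.1.2 h
      · exact hd1 b hb.1 h.2 hb.2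
    · intro h
      have : a ∈ Y ∪ (K \ Y) ∩ v := h.ge ha.1.1
      rcases this with h | h
      · exact ha.1.2 h
      · exact hd1 a ha.1 ha.2 h.2
    · by_cases h : y ∈ Y
      · exact Or.inl (Or.inl h)
      · rcases huv ⟨hy, h⟩ with h' | h'
        · exact Or.inl (Or.inr ⟨⟨hy, h⟩, h'⟩)
        · exact Or.inr (Or.inr ⟨⟨hy, h⟩, h'⟩)

/-- An indecomposable subcontinuum with nonempty interior is irreducible between two points
of its interior. -/
theorem exists_irreducible_pair_of_not_decomposableSet {X : Type*} [TopologicalSpace X]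
    [T2Space X] [CompactSpace X] [SecondCountableTopology X] [ConnectedSpace X] [Nontrivial X]
    {K : Set X} (hK : IsCompact K) (hKconn : IsConnected K) (hKd : ¬ DecomposableSet K)
    (hint : (interior K).Nonempty) :
    ∃ p ∈ interior K, ∃ q ∈ interior K, p ≠ q ∧
      ∀ Y, IsCompact Y → IsConnected Y → Y ⊆ K → p ∈ Y → q ∈ Y → Y = K := by
  obtain ⟨p, hp⟩ := hint
  by_contra! hcon
  let S := {U ∈ TopologicalSpace.countableBasis X | (K ∩ U).Nonempty}
  have : Countable S :=
    ((TopologicalSpace.countable_countableBasis X).mono (sep_subset _ _)).to_subtype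
  let f : Option S → Set X := fun o =>
    o.elim (interior K)ᶜ (fun U => connectedComponentIn (K \ U.1) p)
  have hUo : ∀ U : S, IsOpen U.1 := fun U => TopologicalSpace.isOpen_of_mem_countableBasis U.2.1
  have hcl : ∀ U : S, IsClosed (connectedComponentIn (K \ U.1) p) := fun U =>
    (hK.isClosed.sdiff (hUo U)).isClosed_connectedComponentIn p
  have hfc : ∀ o, IsClosed (f o) := by
    rintro (_ | U)
    · exact isOpen_interior.isClosed_compl
    · exact hcl U
  have hK_ne : ({p} : Set X) ≠ K := by
    intro h
    rw [← h, interior_singleton] at hp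
    exact hp
  have hcov : ⋃ o, f o = univ := by
    rw [Set.eq_univ_iff_forall]
    intro q
    by_cases hq : q ∈ interior K
    · have : ∃ Y, IsCompact Y ∧ IsConnected Y ∧ Y ⊆ K ∧ p ∈ Y ∧ q ∈ Y ∧ Y ≠ K := by
        by_cases hpq : p = q
        · subst hpq
          exact ⟨{p}, isCompact_singleton, isConnected_singleton,
            singleton_subset_iff.2 (interior_subset hp), rfl, rfl, hK_ne⟩
        · exact hcon p hp q hq hpq
      obtain ⟨Y, hY, hYconn, hYK, hpY, hqY, hne⟩ := this
      obtain ⟨z, hzK, hzY⟩ : ∃ z ∈ K, z ∉ Y := by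
        by_contra! h
        exact hne (hYK.antisymm h)
      obtain ⟨U, hU, hzU, hUY⟩ := (TopologicalSpace.isBasis_countableBasis X).exists_subset_of_mem_open
        (show z ∈ Yᶜ from hzY) hY.isClosed.isOpen_compl
      refine Set.mem_iUnion.2 ⟨some ⟨U, hU, z, hzK, hzU⟩, ?_⟩
      have hYU : Y ⊆ K \ U := fun y hy => ⟨hYK hy, fun h => hUY h hy⟩
      exact hYconn.isPreconnected.subset_connectedComponentIn hpY hYU hqY
    · exact Set.mem_iUnion.2 ⟨none, hq⟩
  obtain ⟨w, hw1, hw2⟩ := (dense_iUnion_interior_of_closed hfc hcov).inter_open_nonempty _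
    isOpen_interior ⟨p, hp⟩
  obtain ⟨o, ho⟩ := mem_iUnion.1 hw2
  rcases o with _ | U
  · exact interior_subset ho hw1
  · have hsub : connectedComponentIn (K \ U.1) p ⊆ K \ U.1 := connectedComponentIn_subset _ _
    have ho' : w ∈ interior (connectedComponentIn (K \ U.1) p) := ho
    have hne : (connectedComponentIn (K \ U.1) p).Nonempty := ⟨w, interior_subset ho'⟩
    have hempty := interior_eq_empty_of_not_decomposableSet hK hKconn hKd (hcl U).isCompact
      ⟨hne, isPreconnected_connectedComponentIn⟩ (hsub.trans sdiff_subset) (by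
        intro h
        obtain ⟨z, hzK, hzU⟩ := U.2.2
        exact (hsub (h.symm ▸ hzK)).2 hzU)
    rw [hempty] at ho'
    exact ho'

/-! ### Continua in which the nonblockers are the singletons -/

/-- A point does not block any other point from a nonempty open set. -/
theorem exists_continuum_avoiding_of_NB_eq_F1 {X : Type*} [TopologicalSpace X] (h : NB X = F1 X)
    {p x : X} (hx : x ≠ p) {U : Set X} (hU : IsOpen U) (hne : U.Nonempty) :
    ∃ M, IsCompact M ∧ IsConnected M ∧ x ∈ M ∧ p ∉ M ∧ (M ∩ U).Nonempty := by
  have hp : ({p} : Set X) ∈ NB X := h ▸ ⟨p, rfl⟩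
  obtain ⟨y, hyU, M, ⟨h1, h2, h3, h4⟩, hyM⟩ := (hp.2.2.2 x hx).inter_open_nonempty U hU hne
  exact ⟨M, h1, h2, h3, fun hpM => h4 hpM rfl, y, hyM, hyU⟩

theorem nontrivial_of_NB_eq_F1 {X : Type*} [TopologicalSpace X] [Nonempty X]
    (h : NB X = F1 X) : Nontrivial X := by
  rw [← not_subsingleton_iff_nontrivial]
  intro _
  obtain ⟨x⟩ := ‹Nonempty X›
  have hx : ({x} : Set X) ∈ NB X := h ▸ ⟨x, rfl⟩
  exact hx.2.1 (Set.eq_univ_iff_forall.2 fun y => Subsingleton.elim y x)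

/-- A pair of distinct points blocks some point. -/
theorem exists_not_notBlocks_pair {X : Type*} [TopologicalSpace X] [T1Space X]
    [ConnectedSpace X] [Nontrivial X] (h : NB X = F1 X) {p q : X} (hpq : p ≠ q) :
    ∃ x, x ≠ p ∧ x ≠ q ∧ ¬ NotBlocks {p, q} x := by
  by_contra! hcon
  have hfin : ({p, q} : Set X).Finite := Set.toFinite _
  have hmem : ({p, q} : Set X) ∈ NB X := by
    refine ⟨⟨p, by simp⟩, ?_, hfin.isClosed, fun x hx => ?_⟩
    · intro huniv
      exact (isPreconnected_univ.infinite_of_nontrivial Set.nontrivial_univ) (huniv ▸ hfin)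
    · simp only [mem_insert_iff, mem_singleton_iff, not_or] at hx
      exact hcon x hx.1 hx.2
  rw [h] at hmem
  obtain ⟨z, hz⟩ := hmem
  have h1 : p ∈ ({z} : Set X) := hz ▸ (by simp)
  have h2 : q ∈ ({z} : Set X) := hz ▸ (by simp)
  exact hpq (h1.trans h2.symm)

/-- For distinct `p` and `q` and a continuum `A` missing both, some point can be joined to `A`
only through `p` or `q`. -/
theorem exists_point_separated_by_pair {X : Type*} [TopologicalSpace X] [T1Space X]
    [ConnectedSpace X] [Nontrivial X] (h : NB X = F1 X) {p q : X} (hpq : p ≠ q) {A : Set X}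
    (hA : IsCompact A) (hAconn : IsConnected A) (hpA : p ∉ A) (hqA : q ∉ A) :
    ∃ x, x ≠ p ∧ x ≠ q ∧ ∀ M, IsCompact M → IsConnected M → x ∈ M → p ∉ M → q ∉ M →
      ¬ (M ∩ A).Nonempty := by
  by_contra! hcon
  obtain ⟨x, hxp, hxq, hx⟩ := exists_not_notBlocks_pair h hpq
  apply hx
  have hdense : Dense ({p, q}ᶜ : Set X) := by
    have := (dense_univ (X := X)).sdiff_finite (Set.toFinite ({p, q} : Set X))
    rwa [← Set.compl_eq_univ_sdiff] at this
  refine hdense.mono fun y hy => ?_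
  simp only [mem_compl_iff, mem_insert_iff, mem_singleton_iff, not_or] at hy
  obtain ⟨M, hM, hMconn, hxM, hpM, hqM, hMA⟩ := hcon x hxp hxq
  obtain ⟨N, hN, hNconn, hyN, hpN, hqN, a, haN, haA⟩ := hcon y hy.1 hy.2
  refine ⟨M ∪ A ∪ N, ⟨(hM.union hA).union hN, ?_, Or.inl (Or.inl hxM), ?_⟩, Or.inr hyN⟩
  · exact (hMconn.union hMA hAconn).union ⟨a, Or.inr haA, haN⟩ hNconn
  · rintro z hz hzpq
    rcases hzpq with rfl | hzq
    · rcases hz with (hz | hz) | hz <;> contradiction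
    · rw [mem_singleton_iff] at hzq
      subst hzq
      rcases hz with (hz | hz) | hz <;> contradiction

theorem decomposableSet_univ_of_NB_eq_F1 {X : Type*} [TopologicalSpace X] [T2Space X]
    [CompactSpace X] [SecondCountableTopology X] [ConnectedSpace X] [Nontrivial X]
    (h : NB X = F1 X) : DecomposableSet (univ : Set X) := by
  by_contra hd
  obtain ⟨p, -, q, -, hpq, hirr⟩ := exists_irreducible_pair_of_not_decomposableSet isCompact_univ
    isConnected_univ hd (by simp)
  obtain ⟨x, hxp, hxq, hx⟩ := exists_not_notBlocks_pair h hpq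
  have hP : ∃ M, IsCompact M ∧ IsConnected M ∧ x ∈ M ∧ p ∉ M ∧ q ∈ M := by
    by_contra! hcon
    have hp : ({p} : Set X) ∈ NB X := h ▸ ⟨p, rfl⟩
    refine hx ((hp.2.2.2 x hxp).mono (sUnion_subset_sUnion ?_))
    rintro M ⟨h1, h2, h3, h4⟩
    have hpM : p ∉ M := fun hpM => h4 hpM rfl
    refine ⟨h1, h2, h3, ?_⟩
    rintro z hz (rfl | rfl)
    exacts [hpM hz, hcon M h1 h2 h3 hpM hz]
  have hQ : ∃ M, IsCompact M ∧ IsConnected M ∧ x ∈ M ∧ q ∉ M ∧ p ∈ M := by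
    by_contra! hcon
    have hq : ({q} : Set X) ∈ NB X := h ▸ ⟨q, rfl⟩
    refine hx ((hq.2.2.2 x hxq).mono (sUnion_subset_sUnion ?_))
    rintro M ⟨h1, h2, h3, h4⟩
    have hqM : q ∉ M := fun hqM => h4 hqM rfl
    refine ⟨h1, h2, h3, ?_⟩
    rintro z hz (rfl | rfl)
    exacts [hcon M h1 h2 h3 hqM hz, hqM hz]
  obtain ⟨M, hM, hMconn, hxM, hpM, hqM⟩ := hP
  obtain ⟨N, hN, hNconn, hxN, hqN, hpN⟩ := hQ
  refine hd ⟨M, N, hM, hMconn, subset_univ _, fun h => hpM (h ▸ mem_univ p), hN, hNconn,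
    subset_univ _, fun h => hqN (h ▸ mem_univ q), ?_⟩
  exact hirr _ (hM.union hN) (hMconn.union ⟨x, hxM, hxN⟩ hNconn) (subset_univ _) (Or.inr hpN)
    (Or.inl hqM)

/-- The complement of a subcontinuum with nonempty interior is connected. -/
theorem isPreconnected_compl_of_NB_eq_F1 {X : Type*} [TopologicalSpace X] [T2Space X]
    [ConnectedSpace X] [Nontrivial X] (h : NB X = F1 X) {K : Set X}
    (hK : IsCompact K) (hKconn : IsConnected K) (hint : (interior K).Nonempty) :
    IsPreconnected Kᶜ := by
  by_contra hc
  unfold IsPreconnected at hc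
  push Not at hc
  obtain ⟨u, v, hu, hv, huv, ⟨p, hpK, hpu⟩, ⟨q, hqK, hqv⟩, hd⟩ := hc
  have hd' : ∀ z ∉ K, z ∈ u → z ∉ v := fun z hz h1 h2 =>
    Set.eq_empty_iff_forall_notMem.1 hd z ⟨hz, h1, h2⟩
  obtain ⟨x, hxp, hxq, hx⟩ := exists_point_separated_by_pair h
    (fun hpq : p = q => hd' q hqK (hpq ▸ hpu) hqv) hK hKconn hpK hqK
  have aux : ∀ (s t : Set X) (a b : X), IsOpen s → IsOpen t → Kᶜ ⊆ s ∪ t →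
      (∀ z ∉ K, z ∈ s → z ∉ t) → a ∉ K → b ∉ K → b ∈ t → x ≠ a → x ∉ K → x ∈ s →
      ∃ M, IsCompact M ∧ IsConnected M ∧ x ∈ M ∧ a ∉ M ∧ b ∉ M ∧ (M ∩ K).Nonempty := by
    intro s t a b hs ht hst hdst haK hbK hbt hxa hxK hxs
    obtain ⟨M, hM, hMconn, hxM, haM, w, hwM, hwK⟩ :=
      exists_continuum_avoiding_of_NB_eq_F1 h hxa isOpen_interior hint
    have hcomp : IsCompact (K ∪ M) := hK.union hM
    have hconn : IsConnected (K ∪ M) := hKconn.union ⟨w, interior_subset hwK, hwM⟩ hMconn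
    obtain ⟨hc1, hc2⟩ := hconn.isPreconnected.union_sdiff_inter hcomp.isClosed hKconn hK.isClosed
      subset_union_left hs ht (fun z hz => hst hz.2) (fun z hz => hdst z hz.2)
    refine ⟨_, hcomp.of_isClosed_subset hc1 (union_subset subset_union_left
      (inter_subset_left.trans sdiff_subset)), hc2, Or.inr ⟨⟨Or.inr hxM, hxK⟩, hxs⟩, ?_, ?_,
      w, Or.inl (interior_subset hwK), interior_subset hwK⟩
    · rintro (h1 | h1)
      · exact haK h1
      · rcases h1.1.1 with h2 | h2
        exacts [haK h2, haM h2]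
    · rintro (h1 | h1)
      · exact hbK h1
      · exact hdst b hbK h1.2 hbt
  by_cases hxK : x ∈ K
  · exact hx K hK hKconn hxK hpK hqK ⟨x, hxK, hxK⟩
  · rcases huv hxK with hxu | hxv
    · obtain ⟨M, h1, h2, h3, h4, h5, h6⟩ := aux u v p q hu hv huv hd' hpK hqK hqv hxp hxK hxu
      exact hx M h1 h2 h3 h4 h5 h6
    · obtain ⟨M, h1, h2, h3, h4, h5, h6⟩ := aux v u q p hv hu (by rwa [union_comm])
        (fun z hz h1 h2 => hd' z hz h2 h1) hqK hpK hpu hxq hxK hxv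
      exact hx M h1 h2 h3 h5 h4 h6

theorem interior_eq_empty_of_NB_eq_F1 {X : Type*} [TopologicalSpace X] [T2Space X]
    [CompactSpace X] [SecondCountableTopology X] [ConnectedSpace X] [Nontrivial X]
    (h : NB X = F1 X) {K : Set X} (hK : IsCompact K) (hKconn : IsConnected K)
    (hKd : ¬ DecomposableSet K) : interior K = ∅ := by
  by_contra hint
  rw [← ne_eq, ← Set.nonempty_iff_ne_empty] at hint
  have hKne : Kᶜ.Nonempty := by
    rw [Set.nonempty_compl]
    rintro rfl
    exact hKd (decomposableSet_univ_of_NB_eq_F1 h)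
  have hCconn : IsConnected (closure Kᶜ) :=
    ⟨hKne.closure, (isPreconnected_compl_of_NB_eq_F1 h hK hKconn hint).closure⟩
  have hnotC : ∀ z ∈ interior K, z ∉ closure Kᶜ := fun z hz hzc => by
    rw [closure_compl] at hzc
    exact hzc hz
  obtain ⟨p, hp, q, hq, hpq, hirr⟩ :=
    exists_irreducible_pair_of_not_decomposableSet hK hKconn hKd hint
  obtain ⟨x, hxp, hxq, hx⟩ := exists_point_separated_by_pair h hpq isClosed_closure.isCompact
    hCconn (hnotC p hp) (hnotC q hq)
  by_cases hxK : x ∈ K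
  · have component : ∀ a, x ≠ a → ∃ Y, IsCompact Y ∧ IsConnected Y ∧ Y ⊆ K ∧ x ∈ Y ∧ a ∉ Y ∧
        (Y ∩ closure Kᶜ).Nonempty := by
      intro a hxa
      obtain ⟨M, hM, hMconn, hxM, haM, w, hwM, hwK⟩ :=
        exists_continuum_avoiding_of_NB_eq_F1 h hxa hK.isClosed.isOpen_compl hKne
      have hsub : connectedComponentIn (M ∩ K) x ⊆ M ∩ K := connectedComponentIn_subset _ _
      have hxY : x ∈ connectedComponentIn (M ∩ K) x := mem_connectedComponentIn ⟨hxM, hxK⟩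
      exact ⟨connectedComponentIn (M ∩ K) x,
        ((hM.isClosed.inter hK.isClosed).isClosed_connectedComponentIn x).isCompact,
        ⟨⟨x, hxY⟩, isPreconnected_connectedComponentIn⟩, hsub.trans inter_subset_right, hxY,
        fun ha => haM (hsub ha).1,
        connectedComponentIn_inter_closure_compl_nonempty hMconn.isPreconnected hM hK.isClosed
          ⟨hxM, hxK⟩ (fun hMK => hwK (hMK hwM))⟩
    obtain ⟨Y, hY, hYconn, hYK, hxY, hpY, hYC⟩ := component p hxp
    obtain ⟨Z, hZ, hZconn, hZK, hxZ, hqZ, hZC⟩ := component q hxq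
    by_cases hqY : q ∈ Y
    · by_cases hpZ : p ∈ Z
      · exact hKd ⟨Y, Z, hY, hYconn, hYK, fun h => hpY (h ▸ interior_subset hp), hZ, hZconn, hZK,
          fun h => hqZ (h ▸ interior_subset hq), hirr _ (hY.union hZ)
            (hYconn.union ⟨x, hxY, hxZ⟩ hZconn) (union_subset hYK hZK) (Or.inr hpZ) (Or.inl hqY)⟩
      · exact hx Z hZ hZconn hxZ hpZ hqZ hZC
    · exact hx Y hY hYconn hxY hpY hqY hYC
  · have hxC : x ∈ closure Kᶜ := subset_closure hxK
    exact hx _ isClosed_closure.isCompact hCconn hxC (hnotC p hp) (hnotC q hq) ⟨x, hxC, hxC⟩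

theorem stmt19 (X : Type*) [MetricSpace X] [CompactSpace X] [ConnectedSpace X] [Nonempty X]
    (h : NB X = F1 X) :
    DecomposableSet (univ : Set X) ∧
    ∀ K : Set X, IsCompact K → IsConnected K → ¬ DecomposableSet K → interior K = ∅ := by
  have := nontrivial_of_NB_eq_F1 h
  exact ⟨decomposableSet_univ_of_NB_eq_F1 h,
    fun K hK hKconn hKd => interior_eq_empty_of_NB_eq_F1 h hK hKconn hKd⟩
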